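/- Let q ∈ ℝ, q ≠ 0, and let γ : ℝ → ℍ be a normal magnetic curve of strength q on 𝕊³, i.e. a smooth curve with ‖γ(s)‖ = 1 and ‖γ′(s)‖ = 1 for all s satisfying γ″(s) + γ(s) = q·(γ′(s)·𝐤 + ⟨γ′(s), γ(s)·𝐤⟩·γ(s)) for all s. Let θ be its (constant) contact angle, cos θ = ⟨γ′(s), γ(s)·𝐤⟩, and assume sin θ ≠ 0. Then γ is periodic — i.e. there exists L > 0 with γ(s + L) = γ(s) for all s — if and only if q / √(q² − 4q·cos θ + 4) is a rational number. -/

import Mathlib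

open Quaternion
open scoped RealInnerProductSpace

/-- The quaternion `𝐤`. -/
noncomputable def qk : ℍ[ℝ] := ⟨0, 0, 0, 1⟩

lemma qk_re : qk.re = 0 := rfl
lemma qk_imI : qk.imI = 0 := rfl
lemma qk_imJ : qk.imJ = 0 := rfl
lemma qk_imK : qk.imK = 1 := rfl

lemma qk_mul : qk * qk = -1 := by
  ext <;> simp [qk_re, qk_imI, qk_imJ, qk_imK]

noncomputable def EE (a : ℝ) : ℍ[ℝ] := Real.cos a • (1 : ℍ[ℝ]) + Real.sin a • qk

lemma EE_mul_neg (a : ℝ) : EE (-a) * EE a = 1 := by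
  have := Real.sin_sq_add_cos_sq a
  ext <;> simp [EE, qk_re, qk_imI, qk_imJ, qk_imK]
  · nlinarith
  · ring

lemma EE_comm (a : ℝ) : EE a * qk = qk * EE a := by
  simp [EE, mul_add, add_mul]

lemma EE_deriv (c s : ℝ) : HasDerivAt (fun s => EE (c * s)) (c • (qk * EE (c * s))) s := by
  have h : HasDerivAt (fun s : ℝ => c * s) c s := by
    simpa using (hasDerivAt_id s).const_mul c
  have h1 := (h.cos.smul_const (1 : ℍ[ℝ])).add (h.sin.smul_const qk)
  refine h1.congr_deriv ?_
  simp only [EE, mul_add, mul_smul_comm, mul_one, qk_mul]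
  module

lemma first_order (a : ℝ) (u : ℝ → ℍ[ℝ]) (hu : ∀ s, HasDerivAt u (a • (u s * qk)) s) (s : ℝ) :
    u s = u 0 * EE (a * s) := by
  have hd : ∀ s, HasDerivAt (fun s => u s * EE (-a * s)) 0 s := by
    intro s
    refine ((hu s).mul (EE_deriv (-a) s)).congr_deriv ?_
    simp [mul_assoc]
  have hc := is_const_of_deriv_eq_zero (fun s => (hd s).differentiableAt)
    (fun s => (hd s).deriv) s 0
  have h0 : EE 0 = 1 := by simp [EE]
  simp only [mul_zero, h0, mul_one] at hc
  rw [← hc, mul_assoc, neg_mul, EE_mul_neg, mul_one]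

lemma EE_eq_one {a : ℝ} (h : EE a = 1) : ∃ n : ℤ, (n : ℝ) * (2 * Real.pi) = a := by
  have : Real.cos a = 1 := by
    have := congrArg (fun x : ℍ[ℝ] => x.re) h
    simpa [EE, qk_re] using this
  exact (Real.cos_eq_one_iff a).1 this

lemma EE_per (a : ℝ) (n : ℤ) : EE (a + n * (2 * Real.pi)) = EE a := by
  simp [EE, Real.cos_add_int_mul_two_pi, Real.sin_add_int_mul_two_pi]

lemma norm_qk : ‖qk‖ = 1 := by
  have h : ‖qk‖ * ‖qk‖ = 1 := by rw [← norm_mul, qk_mul]; simp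
  nlinarith [norm_nonneg qk]

lemma nonzero_aux (b θ : ℝ) (hθ : Real.sin θ ≠ 0) (x y : ℍ[ℝ]) (hx : ‖x‖ = 1) (hy : ‖y‖ = 1)
    (h : ⟪y, x * qk⟫ = Real.cos θ) : y - b • (x * qk) ≠ 0 := by
  intro h0
  have e : y = b • (x * qk) := sub_eq_zero.1 h0
  have hn : ‖x * qk‖ = 1 := by rw [norm_mul, hx, norm_qk, mul_one]
  rw [e, norm_smul, hn, mul_one, Real.norm_eq_abs] at hy
  rw [e, real_inner_smul_left, real_inner_self_eq_norm_sq, hn] at h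
  have h2 : b ^ 2 = 1 := by rw [← sq_abs, hy]; norm_num
  apply hθ
  have := Real.sin_sq_add_cos_sq θ
  have h3 : Real.sin θ ^ 2 = 0 := by rw [← h] at this; nlinarith
  exact pow_eq_zero_iff (two_ne_zero) |>.1 h3

/-- Criterion of periodicity for magnetic curves on `𝕊³`: a normal
magnetic curve `γ` of strength `q ≠ 0` on the unit sphere (unit quaternions) with
constant contact angle `θ` (so `cos θ = ⟨γ′, γ·𝐤⟩`, `sin θ ≠ 0`) is periodic if and
only if `q / √(q² − 4q cos θ + 4)` is a rational number. -/
theorem periodicity_criterion_for_magnetic_curves_on_S3 (q θ : ℝ) (hq : q ≠ 0)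
    (hθ : Real.sin θ ≠ 0)
    (γ : ℝ → ℍ[ℝ])
    (hsmooth : ContDiff ℝ (⊤ : ℕ∞) γ)
    (hsphere : ∀ s : ℝ, ‖γ s‖ = 1)
    (hspeed : ∀ s : ℝ, ‖deriv γ s‖ = 1)
    (hlorentz : ∀ s : ℝ, deriv (deriv γ) s + γ s =
      q • (deriv γ s * qk + ⟪deriv γ s, γ s * qk⟫ • γ s))
    (hangle : ∀ s : ℝ, ⟪deriv γ s, γ s * qk⟫ = Real.cos θ) :
    (∃ L : ℝ, 0 < L ∧ ∀ s : ℝ, γ (s + L) = γ s) ↔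
    (∃ r : ℚ, q / Real.sqrt (q ^ 2 - 4 * q * Real.cos θ + 4) = (r : ℝ)) := by
  have hpos : 0 < q ^ 2 - 4 * q * Real.cos θ + 4 := by
    have h1 := Real.sin_sq_add_cos_sq θ
    have h2 : 0 < Real.sin θ ^ 2 := by positivity
    nlinarith [sq_nonneg (q - 2 * Real.cos θ)]
  set w := Real.sqrt (q ^ 2 - 4 * q * Real.cos θ + 4) with hw
  have hw0 : 0 < w := Real.sqrt_pos.2 hpos
  have hw2 : w ^ 2 = q ^ 2 - 4 * q * Real.cos θ + 4 := Real.sq_sqrt hpos.le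
  have hd1 : ∀ s, HasDerivAt γ (deriv γ s) s := fun s =>
    (hsmooth.differentiable (by simp) s).hasDerivAt
  have hd2 : ∀ s, HasDerivAt (deriv γ) (deriv (deriv γ) s) s := fun s => by
    have h : ContDiff ℝ 1 (deriv γ) :=
      ContDiff.iterate_deriv' 1 1 (hsmooth.of_le (by
        norm_cast))
    exact (h.differentiable (by simp) s).hasDerivAt
  have key : ∀ a b : ℝ, a + b = q → a * b = q * Real.cos θ - 1 → ∀ s,
      deriv γ s - b • (γ s * qk) = (deriv γ 0 - b • (γ 0 * qk)) * EE (a * s) := by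
    intro a b hab hm s
    refine first_order a (fun s => deriv γ s - b • (γ s * qk)) (fun s => ?_) s
    refine ((hd2 s).sub (((hd1 s).mul_const qk).const_smul b)).congr_deriv ?_
    have hl := hlorentz s
    rw [hangle s] at hl
    have hl' : deriv (deriv γ) s =
        q • (deriv γ s * qk + Real.cos θ • γ s) - γ s := eq_sub_of_add_eq hl
    rw [hl', sub_mul, smul_mul_assoc, mul_assoc, qk_mul, ← hab]
    have hm' : (a + b) * Real.cos θ = a * b + 1 := by rw [hab, hm]; ring
    rw [smul_add, smul_smul, hm', mul_neg_one]
    module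
  have hu := key ((q + w) / 2) ((q - w) / 2) (by ring) (by nlinarith)
  have hv := key ((q - w) / 2) ((q + w) / 2) (by ring) (by nlinarith)
  have hu0 := nonzero_aux ((q - w) / 2) θ hθ _ _ (hsphere 0) (hspeed 0) (hangle 0)
  have hv0 := nonzero_aux ((q + w) / 2) θ hθ _ _ (hsphere 0) (hspeed 0) (hangle 0)
  constructor
  · rintro ⟨L, hL, hper⟩
    have hdper : deriv γ L = deriv γ 0 := by
      have h : (fun s => γ (s + L)) = γ := funext hper
      have h2 := deriv_comp_add_const γ L 0
      rw [h, zero_add] at h2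
      exact h2.symm
    have hγ : γ L = γ 0 := by simpa using hper 0
    have hu1 := hu L
    have hv1 := hv L
    rw [hdper, hγ] at hu1 hv1
    obtain ⟨m, hm⟩ := EE_eq_one (mul_left_cancel₀ hu0 (by rw [← hu1, mul_one]))
    obtain ⟨n, hn⟩ := EE_eq_one (mul_left_cancel₀ hv0 (by rw [← hv1, mul_one]))
    refine ⟨((m + n : ℤ) : ℚ) / ((m - n : ℤ) : ℚ), ?_⟩
    have e1 : ((m : ℝ) + n) * (2 * Real.pi) = q * L := by linarith
    have e2 : ((m : ℝ) - n) * (2 * Real.pi) = w * L := by linarith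
    have hp : 2 * Real.pi ≠ 0 := by positivity
    push_cast
    rw [← mul_div_mul_right q w hL.ne', ← e1, ← e2, mul_div_mul_right _ _ hp]
  · rintro ⟨r, hr⟩
    have hrd : (r.den : ℝ) ≠ 0 := by exact_mod_cast r.den_ne_zero
    have hrd' : 0 < (r.den : ℝ) := by exact_mod_cast r.den_pos
    have hr' : q * r.den = r.num * w := by
      rw [Rat.cast_def, div_eq_div_iff hw0.ne' hrd] at hr
      exact hr
    refine ⟨4 * Real.pi * r.den / w, by positivity, fun s => ?_⟩
    have hq' : q = r.num * w / r.den := by rw [← hr']; field_simp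
    have e1 : (q + w) / 2 * (s + 4 * Real.pi * r.den / w) =
        (q + w) / 2 * s + ((r.num + r.den : ℤ) : ℝ) * (2 * Real.pi) := by
      push_cast
      rw [hq']; field_simp
      ring
    have e2 : (q - w) / 2 * (s + 4 * Real.pi * r.den / w) =
        (q - w) / 2 * s + ((r.num - r.den : ℤ) : ℝ) * (2 * Real.pi) := by
      push_cast
      rw [hq']; field_simp
      ring
    have hu1 := hu (s + 4 * Real.pi * r.den / w)
    have hv1 := hv (s + 4 * Real.pi * r.den / w)
    rw [e1, EE_per, ← hu s] at hu1
    rw [e2, EE_per, ← hv s] at hv1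
    generalize s + 4 * Real.pi * r.den / w = t at *
    have h3 : w • (γ t * qk) = w • (γ s * qk) := by
      have h4 := congrArg₂ (· - ·) hu1 hv1
      calc w • (γ t * qk) = (deriv γ t - ((q - w) / 2) • (γ t * qk)) -
            (deriv γ t - ((q + w) / 2) • (γ t * qk)) := by module
        _ = _ := h4
        _ = _ := by module
    have h5 := smul_right_injective _ hw0.ne' h3
    have hk : qk ≠ 0 := by
      intro h; have := norm_qk; rw [h] at this; simp at this
    exact mul_right_cancel₀ hk h5
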